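/- The function ρ is a 2√2-pseudo-inframetric on 𝔪: for all rotation matrices Q₁, Q₂, Q₃ ∈ 𝔪, ρ(Q₁,Q₃) ≤ 2√2 [ρ(Q₁,Q₂) + ρ(Q₂,Q₃)]; moreover p₁(D,Q) = −p₁(Q,D), p₂(D,Q) = p₂(Q,D) and p₁(Q,Q) = 0 for all D, Q ∈ 𝔪. -/

import Mathlib

open MeasureTheory Matrix Filter
open scoped Classical ENNReal

noncomputable section

/-- Vectors in `ℝ²`. -/
abbrev V2 : Type := Fin 2 → ℝ

/-- `2 × 2` real matrices. -/
abbrev Mat2 : Type := Matrix (Fin 2) (Fin 2) ℝ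

/-- `Q` is a `2 × 2` rotation matrix, i.e. `Q = (q, q⊥)` with `q = (q₁,q₂)ᵀ`,
`q⊥ = (-q₂,q₁)ᵀ` and `q₁² + q₂² = 1`. -/
def IsRotation (Q : Mat2) : Prop :=
  Q 0 0 = Q 1 1 ∧ Q 0 1 = -Q 1 0 ∧ Q 0 0 ^ 2 + Q 1 0 ^ 2 = 1

/-- The `j`-th column of a `2 × 2` matrix. -/
def mcol (Q : Mat2) (j : Fin 2) : V2 := fun i => Q i j

/-- `p₁(D,Q) = qᵀ d⊥`. -/
def p1 (D Q : Mat2) : ℝ := mcol Q 0 ⬝ᵥ mcol D 1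

/-- `p₂(D,Q) = qᵀ d`. -/
def p2 (D Q : Mat2) : ℝ := mcol Q 0 ⬝ᵥ mcol D 0

/-- `ρ(D,Q) = min (|p₁(Q,D)|, |p₂(D,Q)|)`. -/
def rho (D Q : Mat2) : ℝ := min |p1 Q D| |p2 D Q|

/-- A finite set of rotation matrices whose distinct elements are pairwise
`δ`-distinguishable with respect to `ρ`. -/
def IsSep (δ : ℝ) (S : Finset Mat2) : Prop :=
  (∀ M ∈ S, IsRotation M) ∧ ∀ M ∈ S, ∀ M' ∈ S, M ≠ M' → δ ≤ rho M M'

/-- The Hölder class `H(β,L)` on `ℝ`: with `r = ⌈β⌉ - 1` and `α = β - r ∈ (0,1]`,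
`w` is `r` times continuously differentiable, all derivatives up to order `r` are
bounded by `L`, and the `r`-th derivative is `α`-Hölder with constant `L`. -/
def holder (β L : ℝ) (w : ℝ → ℝ) : Prop :=
  ContDiff ℝ ((⌈β⌉₊ - 1 : ℕ) : ℕ∞) w ∧
    (∀ j : ℕ, j ≤ ⌈β⌉₊ - 1 → ∀ y : ℝ, |iteratedDeriv j w y| ≤ L) ∧
    ∀ y z : ℝ,
      |iteratedDeriv (⌈β⌉₊ - 1) w (y + z) - iteratedDeriv (⌈β⌉₊ - 1) w y| ≤
        L * |z| ^ (β - ((⌈β⌉₊ - 1 : ℕ) : ℝ))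

/-- The class `G(β,L)` of product densities `g(x₁,x₂) = g₁(x₁) g₂(x₂)` where
`g₁, g₂` are symmetric probability densities in `H(β,L)`. -/
def memG (β L : ℝ) (g : V2 → ℝ) : Prop :=
  ∃ g₁ g₂ : ℝ → ℝ,
    holder β L g₁ ∧ holder β L g₂ ∧ (∀ y, 0 ≤ g₁ y) ∧ (∀ y, 0 ≤ g₂ y) ∧
      (∀ y, g₁ (-y) = g₁ y) ∧ (∀ y, g₂ (-y) = g₂ y) ∧
      (∫ y, g₁ y) = 1 ∧ (∫ y, g₂ y) = 1 ∧ ∀ v : V2, g v = g₁ (v 0) * g₂ (v 1)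

/-- The class `F(β,L,𝒬)` of densities `f(∙) = g(Mᵀ∙)` with `g ∈ G(β,L)`, `M ∈ 𝒬`
a rotation matrix. -/
def memF (β L : ℝ) (S : Set Mat2) (f : V2 → ℝ) : Prop :=
  ∃ g : V2 → ℝ, memG β L g ∧ ∃ M ∈ S, IsRotation M ∧ ∀ v : V2, f v = g (Mᵀ *ᵥ v)

/-- The measure on `ℝ²` with density `f` with respect to the Lebesgue measure. -/
def densM (f : V2 → ℝ) : Measure V2 :=
  MeasureTheory.volume.withDensity fun y => ENNReal.ofReal (f y)

/-- The joint law of `n` i.i.d. observations with common density `f`. -/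
def jointM (n : ℕ) (f : V2 → ℝ) : Measure (Fin n → V2) :=
  Measure.pi fun _ => densM f

/-- The pointwise risk `R_n^{(p)}[T, f] = (E_f |T - f(x)|^p)^{1/p}` (in `ℝ≥0∞`). -/
def risk (p : ℝ) (n : ℕ) (x : V2) (f : V2 → ℝ) (T : (Fin n → V2) → ℝ) : ℝ≥0∞ :=
  (∫⁻ ω, ENNReal.ofReal |T ω - f x| ^ p ∂jointM n f) ^ (1 / p)

/-- The kernel class `𝕂_β`: integrable, bounded, integrating to one, with vanishing
moments up to order `2⌊β⌋` and finite moment of order `2β`. -/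
def memK (β : ℝ) (K : ℝ → ℝ) : Prop :=
  Integrable K ∧ (∃ C, ∀ u, |K u| ≤ C) ∧ (∫ u, K u) = 1 ∧
    (∀ j : ℕ, 1 ≤ j → j ≤ 2 * ⌊β⌋₊ → (∫ u, K u * u ^ j) = 0) ∧
    Integrable fun t => |K t| * |t| ^ (2 * β)

/-- The constant `C(K,β,s)`. -/
def CK (K : ℝ → ℝ) (β s : ℝ) : ℝ :=
  ⨆ b : {b : ℝ // b ≤ β},
    ∫ t : ℝ × ℝ, |K t.1 * K t.2| * (s * (t.1 ^ 2 + t.2 ^ 2) ^ (b : ℝ) + 1) ^ 2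

/-- The rescaled kernel `K_h(u) = h⁻¹ K(u/h)`. -/
def Kh (K : ℝ → ℝ) (h u : ℝ) : ℝ := h⁻¹ * K (u / h)

/-- The bivariate product kernel `K_h(t) = K_h(t₁) K_h(t₂)`. -/
def K2 (K : ℝ → ℝ) (h : ℝ) (t : V2) : ℝ := Kh K h (t 0) * Kh K h (t 1)

/-- The matrix `Γ = [[1,0],[0,-1]]`. -/
def Γm : Mat2 := !![1, 0; 0, -1]

/-- The matrix `Ω = [[0,1],[1,0]]`. -/
def Ωm : Mat2 := !![0, 1; 1, 0]

/-- Marginal kernel estimator in direction `b`, built from the observations with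
indices in `I`. -/
def margEstI (K : ℝ → ℝ) (h : ℝ) (b x : V2) {n : ℕ} (I : Finset (Fin n))
    (ω : Fin n → V2) : ℝ :=
  (I.card : ℝ)⁻¹ * ∑ k ∈ I, Kh K h (b ⬝ᵥ (ω k - x))

/-- The estimator `f̃_{h,D}(x)`: product of the marginal estimators along the two
columns of `D`, built from the observations with indices in `I`. -/
def prodEstI (K : ℝ → ℝ) (h : ℝ) (D : Mat2) (x : V2) {n : ℕ} (I : Finset (Fin n))
    (ω : Fin n → V2) : ℝ :=
  margEstI K h (mcol D 0) x I ω * margEstI K h (mcol D 1) x I ω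

/-- The auxiliary `U`-statistic estimator `f̄_{h,(D,Q)}(x)`. -/
def auxEstI (K : ℝ → ℝ) (h : ℝ) (D Q : Mat2) (x : V2) {n : ℕ} (I : Finset (Fin n))
    (ω : Fin n → V2) : ℝ :=
  ((I.card : ℝ) * ((I.card : ℝ) - 1))⁻¹ *
    ∑ k ∈ I, ∑ l ∈ I,
      if k = l then 0
      else
        K2 K h
          (p1 D Q • ((Ωm * Γm) *ᵥ ω k) + p2 D Q • ω l - (Ωm * Γm * Q * D * Ωm) *ᵥ x)

/-- `f̃_{h,(D,Q)}(x)`: the auxiliary estimator if `D ≠ Q`, and `f̃_{h,Q}(x)` if `D = Q`. -/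
def pairEstI (K : ℝ → ℝ) (h : ℝ) (D Q : Mat2) (x : V2) {n : ℕ} (I : Finset (Fin n))
    (ω : Fin n → V2) : ℝ :=
  if D = Q then prodEstI K h Q x I ω else auxEstI K h D Q x I ω

/-- The bandwidth grid `𝓗 = {e^{-k}, k = 0, …, ⌊ln ν⌋}`. -/
def Hgrid (ν : ℕ) : Finset ℝ :=
  (Finset.range (⌊Real.log (ν : ℝ)⌋₊ + 1)).image fun k => Real.exp (-(k : ℝ))

/-- The bandwidth set `𝕄H = {h ∈ 𝓗 : (ln ν)²/ν ≤ h ≤ 1/ln(ln ν)}`. -/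
def MH (ν : ℕ) : Finset ℝ :=
  (Hgrid ν).filter fun h => Real.log (ν : ℝ) ^ 2 / (ν : ℝ) ≤ h ∧ h ≤ 1 / Real.log (Real.log (ν : ℝ))

/-- The sup-norm `‖K‖_∞`. -/
def supNorm (K : ℝ → ℝ) : ℝ := ⨆ u : ℝ, |K u|

/-- The `L₁`-norm `‖K‖₁`. -/
def L1norm (K : ℝ → ℝ) : ℝ := ∫ u, |K u|

/-- The squared `L₂`-norm `‖K‖₂²`. -/
def sqL2 (K : ℝ → ℝ) : ℝ := ∫ u, K u ^ 2

/-- The constant `α = 1 ∨ sup_{n ≥ 3} [(1 ∨ 𝔫(𝒬_{δ_n})) / ln n]`. -/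
def alphaConst (𝒬 : ℕ → Finset Mat2) : ℝ :=
  max 1
    (⨆ ν : {ν : ℕ // 3 ≤ ν},
      max 1 (Real.log (((𝒬 ν.1).card : ℝ))) / Real.log ((ν.1 : ℕ) : ℝ))

/-- The constant `A = 12√(10pα)(1+√(5p))(1 ∨ ‖K‖_∞) + 4C(K,𝔟,√2)`. -/
def Aconst (K : ℝ → ℝ) (b p a : ℝ) : ℝ :=
  12 * Real.sqrt (10 * p * a) * (1 + Real.sqrt (5 * p)) * max 1 (supNorm K) +
    4 * CK K b (Real.sqrt 2)

/-- The random quantity `Û_n`. -/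
def UhatI (K : ℝ → ℝ) (S : Finset Mat2) (x : V2) {n : ℕ} (I : Finset (Fin n))
    (ω : Fin n → V2) : ℝ :=
  ⨆ η ∈ MH I.card, ⨆ D ∈ S, ⨆ b ∈ ({mcol D 0, mcol D 1} : Set V2),
    max 1 (((I.card : ℝ)⁻¹ * ∑ k ∈ I, |Kh K η (b ⬝ᵥ (ω k - x))|) ^ 2)

/-- The quantity `R_n(Q,h)` of the adaptive selection rule. -/
def RnI (K : ℝ → ℝ) (A : ℝ) (S : Finset Mat2) (x : V2) {n : ℕ} (I : Finset (Fin n))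
    (Q : Mat2) (h : ℝ) (ω : Fin n → V2) : ℝ :=
  ⨆ η ∈ MH I.card, ⨆ η' ∈ MH I.card, ⨆ _ : η' ≤ η ∧ η ≤ h, ⨆ D ∈ S,
    max 0
      (|pairEstI K η D Q x I ω - prodEstI K η' D x I ω| -
        A * UhatI K S x I ω * Real.sqrt (Real.log (I.card : ℝ) / ((I.card : ℝ) * η')))

/-- The criterion `R_n(Q,h) + A Û_n √(ln n / (n h))` minimized by the adaptive
selection rule. -/
def crit (K : ℝ → ℝ) (A : ℝ) (S : Finset Mat2) (x : V2) {n : ℕ} (I : Finset (Fin n))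
    (Q : Mat2) (h : ℝ) (ω : Fin n → V2) : ℝ :=
  RnI K A S x I Q h ω +
    A * UhatI K S x I ω * Real.sqrt (Real.log (I.card : ℝ) / ((I.card : ℝ) * h))

/-- `κ_h(D,Q,x)`: the expectation of the auxiliary estimator if `D ≠ Q`, and the
product of the expectations of the two marginal estimators if `D = Q`. -/
def kappaI (K : ℝ → ℝ) (h : ℝ) (D Q : Mat2) (x : V2) (n : ℕ) (f : V2 → ℝ)
    (I : Finset (Fin n)) : ℝ :=
  if D = Q then
    (∫ ω, margEstI K h (mcol Q 0) x I ω ∂jointM n f) *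
      ∫ ω, margEstI K h (mcol Q 1) x I ω ∂jointM n f
  else ∫ ω, pairEstI K h D Q x I ω ∂jointM n f

/-- The random quantity `ζ_n(f,x)`. -/
def zeta (K : ℝ → ℝ) (a : ℝ) (S : Finset Mat2) (x : V2) (n : ℕ) (f : V2 → ℝ)
    (ω : Fin n → V2) : ℝ :=
  ⨆ h ∈ MH n, ⨆ D ∈ S, ⨆ Q ∈ S,
    max 0
      (|pairEstI K h D Q x Finset.univ ω - kappaI K h D Q x n f Finset.univ| -
        a * UhatI K S x Finset.univ ω * Real.sqrt (Real.log (n : ℝ) / ((n : ℝ) * h)))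

/-- The recursion `ℓ₀ = ln n`, `ℓ_{i+1} = ln ℓ_i`. -/
def lseq (n : ℕ) : ℕ → ℝ
  | 0 => Real.log n
  | i + 1 => Real.log (lseq n i)

/-- `ω₀ = ln n` and `ω_i = (ℓ_i ∨ 4) + 𝔫` for `i ≥ 1` where `m = 𝔫(𝒬_{δ_n})`. -/
def wseq (m : ℝ) (n : ℕ) : ℕ → ℝ
  | 0 => Real.log n
  | i + 1 => max (lseq n (i + 1)) 4 + m

/-- `i* = min {i ≥ 1 : ω_i = 4 + 𝔫}`. -/
def istar (m : ℝ) (n : ℕ) : ℕ := sInf {i : ℕ | 1 ≤ i ∧ wseq m n i = 4 + m}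

/-- `𝐧ᵢ = ⌊n ℓᵢ⁻¹⌋`. -/
def nbl (n i : ℕ) : ℕ := ⌊(n : ℝ) * (lseq n i)⁻¹⌋₊

/-- `Nᵢ = ⌊n/4⌋ + Σ_{j=1}^i 𝐧ⱼ`. -/
def Nbl (n i : ℕ) : ℕ := n / 4 + ∑ j ∈ Finset.Icc 1 i, nbl n j

/-- The size of the `i`-th data block. -/
def bsize (m : ℝ) (n i : ℕ) : ℕ :=
  if i = 0 then n / 4
  else if i = istar m n then n - Nbl n (istar m n - 1)
  else nbl n i

/-- The index set of the `i`-th data block `X^{(i)}`. -/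
def blockI (m : ℝ) (n i : ℕ) : Finset (Fin n) :=
  if i = 0 then Finset.univ.filter fun k => (k : ℕ) < n / 4
  else if i = istar m n then Finset.univ.filter fun k => Nbl n (istar m n - 1) ≤ (k : ℕ)
  else Finset.univ.filter fun k => Nbl n (i - 1) ≤ (k : ℕ) ∧ (k : ℕ) < Nbl n i

/-- The bandwidth `h_i = (L⁻⁴ ω_i / 𝐧_i)^{1/(2β+1)}`. -/
def hstep (β L m : ℝ) (n i : ℕ) : ℝ :=
  ((L ^ 4)⁻¹ * wseq m n i / (bsize m n i : ℝ)) ^ (1 / (2 * β + 1))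

/-- The constant `C(β)`. -/
def Cbeta (β : ℝ) : ℝ :=
  max 1
    (⨆ ν : {ν : ℕ // 3 ≤ ν},
      (Real.log ((ν.1 : ℕ) : ℝ) ^ 2 / ((ν.1 : ℕ) : ℝ)) ^ (2 * β / (2 * β + 1)) *
        Real.log ((ν.1 : ℕ) : ℝ) ^ (2 / (2 * β + 1)))

/-- The constant `B` of the minimax selection rule. -/
def Bconst (K : ℝ → ℝ) (p β L a : ℝ) : ℝ :=
  527730 * p ^ 2 * Real.sqrt 6 * max (max (L1norm K ^ 2) (sqL2 K)) (supNorm K ^ 2) *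
        (9 + 4 * a) ^ ((3 * β + 3) / (2 * β + 1)) * Cbeta β ^ ((3 : ℝ) / 2) *
        L ^ ((4 * β + 8) / (2 * β + 1)) +
    8 * CK K β (Real.sqrt 2) * L ^ 2

/-- The random quantity `χ_i(f,x)` (for a generic data block `I` and bandwidth `h`). -/
def chiI (K : ℝ → ℝ) (Cc β L : ℝ) (S : Finset Mat2) (x : V2) (n : ℕ) (f : V2 → ℝ)
    (I : Finset (Fin n)) (h : ℝ) (ω : Fin n → V2) : ℝ :=
  ⨆ D ∈ S, ⨆ Q ∈ S,
    max 0 (|pairEstI K h D Q x I ω - kappaI K h D Q x n f I| - Cc * L ^ 2 * h ^ β)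

/-- The quantity `R_n^{(i)}(Q)` of the minimax selection rule. -/
def Rblock (K : ℝ → ℝ) (B β L m : ℝ) (S : Finset Mat2) (x : V2) {n : ℕ} (i : ℕ)
    (Q : Mat2) (ω : Fin n → V2) : ℝ :=
  ⨆ D ∈ S,
    max 0
      (|pairEstI K (hstep β L m n i) D Q x (blockI m n i) ω -
          prodEstI K (hstep β L m n i) D x (blockI m n i) ω| -
        B * L ^ 2 * hstep β L m n i ^ β)

/-- `τ_f(D)` (for the representation `f = g(Q_fᵀ ∙)` and `fx = f(x)`). -/
def tau (g : V2 → ℝ) (Qf D : Mat2) (x : V2) (fx : ℝ) : ℝ :=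
  if D = Qf then fx
  else
    ∫ u : V2,
      g (p1 D Qf • (Γm *ᵥ u)) *
        g ((p1 D Qf)⁻¹ • ((D * Ωm) *ᵥ x) + p2 D Qf • ((Ωm * Γm) *ᵥ u))

/-- The centered Gaussian density with variance `σ2`. -/
def gauss (σ2 y : ℝ) : ℝ :=
  (Real.sqrt (2 * Real.pi * σ2))⁻¹ * Real.exp (-(y ^ 2) / (2 * σ2))


lemma p1_eq {D Q : Mat2} (hD : IsRotation D) :
    p1 D Q = Q 1 0 * D 0 0 - Q 0 0 * D 1 0 := by
  obtain ⟨h₁, h₂, -⟩ := hD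
  simp only [p1, mcol, dotProduct, Fin.sum_univ_two, h₂, ← h₁]
  ring

lemma p2_eq (D Q : Mat2) : p2 D Q = Q 0 0 * D 0 0 + Q 1 0 * D 1 0 := by
  simp [p2, mcol, dotProduct, Fin.sum_univ_two]

/-- The addition formula for the sine of the angle between two rotations. -/
lemma p1_add {Q₁ Q₂ Q₃ : Mat2} (h₂ : IsRotation Q₂) (h₃ : IsRotation Q₃) :
    p1 Q₃ Q₁ = p1 Q₂ Q₁ * p2 Q₂ Q₃ + p2 Q₁ Q₂ * p1 Q₃ Q₂ := by
  rw [p1_eq h₃, p1_eq h₂, p1_eq h₃, p2_eq, p2_eq]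
  linear_combination (-(Q₁ 1 0 * Q₃ 0 0 - Q₁ 0 0 * Q₃ 1 0)) * h₂.2.2

/-- The addition formula for the cosine of the angle between two rotations. -/
lemma p2_add {Q₁ Q₂ Q₃ : Mat2} (h₂ : IsRotation Q₂) (h₃ : IsRotation Q₃) :
    p2 Q₁ Q₃ = p2 Q₁ Q₂ * p2 Q₂ Q₃ - p1 Q₂ Q₁ * p1 Q₃ Q₂ := by
  rw [p1_eq h₂, p1_eq h₃, p2_eq, p2_eq, p2_eq]
  linear_combination (-(Q₁ 0 0 * Q₃ 0 0 + Q₁ 1 0 * Q₃ 1 0)) * h₂.2.2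

lemma p1_sq_add_p2_sq {D Q : Mat2} (hD : IsRotation D) (hQ : IsRotation Q) :
    p1 Q D ^ 2 + p2 D Q ^ 2 = 1 := by
  rw [p1_eq hQ, p2_eq]
  linear_combination (Q 0 0 ^ 2 + Q 1 0 ^ 2) * hD.2.2 + hQ.2.2

lemma abs_p1_le_one {D Q : Mat2} (hD : IsRotation D) (hQ : IsRotation Q) : |p1 Q D| ≤ 1 :=
  abs_le_one_iff_mul_self_le_one.2 (by nlinarith [p1_sq_add_p2_sq hD hQ, sq_nonneg (p2 D Q)])

lemma abs_p2_le_one {D Q : Mat2} (hD : IsRotation D) (hQ : IsRotation Q) : |p2 D Q| ≤ 1 :=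
  abs_le_one_iff_mul_self_le_one.2 (by nlinarith [p1_sq_add_p2_sq hD hQ, sq_nonneg (p1 Q D)])

lemma rho_nonneg (D Q : Mat2) : 0 ≤ rho D Q :=
  le_min (abs_nonneg _) (abs_nonneg _)

/-- On rotation matrices, `rho` satisfies the triangle inequality. -/
lemma rho_triangle {Q₁ Q₂ Q₃ : Mat2} (h₁ : IsRotation Q₁) (h₂ : IsRotation Q₂)
    (h₃ : IsRotation Q₃) : rho Q₁ Q₃ ≤ rho Q₁ Q₂ + rho Q₂ Q₃ := by
  have hs := abs_add_le (p1 Q₂ Q₁ * p2 Q₂ Q₃) (p2 Q₁ Q₂ * p1 Q₃ Q₂)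
  have hc := abs_sub (p2 Q₁ Q₂ * p2 Q₂ Q₃) (p1 Q₂ Q₁ * p1 Q₃ Q₂)
  rw [← p1_add h₂ h₃, abs_mul, abs_mul] at hs
  rw [← p2_add h₂ h₃, abs_mul, abs_mul] at hc
  have hs₁ := abs_p1_le_one h₁ h₂
  have hc₁ := abs_p2_le_one h₁ h₂
  have hs₂ := abs_p1_le_one h₂ h₃
  have hc₂ := abs_p2_le_one h₂ h₃
  have mul_le_left {a b : ℝ} (hb : |b| ≤ 1) : |a| * |b| ≤ |a| :=
    mul_le_of_le_one_right (abs_nonneg a) hb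
  have mul_le_right {a b : ℝ} (ha : |a| ≤ 1) : |a| * |b| ≤ |b| :=
    mul_le_of_le_one_left (abs_nonneg b) ha
  unfold rho
  rcases min_cases |p1 Q₂ Q₁| |p2 Q₁ Q₂| with ⟨e₁, -⟩ | ⟨e₁, -⟩ <;>
    rcases min_cases |p1 Q₃ Q₂| |p2 Q₂ Q₃| with ⟨e₂, -⟩ | ⟨e₂, -⟩ <;> rw [e₁, e₂]
  · exact (min_le_left _ _).trans (hs.trans (add_le_add (mul_le_left hc₂) (mul_le_right hc₁)))
  · refine (min_le_right _ _).trans (hc.trans ?_)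
    rw [add_comm]
    exact add_le_add (mul_le_left hs₂) (mul_le_right hc₁)
  · exact (min_le_right _ _).trans (hc.trans (add_le_add (mul_le_left hc₂) (mul_le_right hs₁)))
  · refine (min_le_left _ _).trans (hs.trans ?_)
    rw [add_comm]
    exact add_le_add (mul_le_left hs₂) (mul_le_right hs₁)

/-- Remark 1: `ρ` is a `2√2`-pseudo-inframetric on the set of
rotation matrices, and basic (anti)symmetry properties of `p₁, p₂`. -/
theorem statement16 :
    (∀ Q₁ Q₂ Q₃ : Mat2, IsRotation Q₁ → IsRotation Q₂ → IsRotation Q₃ →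
        rho Q₁ Q₃ ≤ 2 * Real.sqrt 2 * (rho Q₁ Q₂ + rho Q₂ Q₃)) ∧
      (∀ D Q : Mat2, IsRotation D → IsRotation Q →
        p1 D Q = -p1 Q D ∧ p2 D Q = p2 Q D) ∧
      ∀ Q : Mat2, IsRotation Q → p1 Q Q = 0 := by
  refine ⟨fun Q₁ Q₂ Q₃ h₁ h₂ h₃ => (rho_triangle h₁ h₂ h₃).trans ?_, fun D Q hD hQ => ⟨?_, ?_⟩,
    fun Q hQ => ?_⟩
  · have h : 1 ≤ Real.sqrt 2 := Real.one_le_sqrt.2 one_le_two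
    exact le_mul_of_one_le_left (add_nonneg (rho_nonneg _ _) (rho_nonneg _ _)) (by linarith)
  · rw [p1_eq hD, p1_eq hQ]
    ring
  · exact dotProduct_comm _ _
  · rw [p1_eq hQ]
    ring

end
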